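/- arXiv:1907.08626 — 8 statements merged into one kernel-verified Lean document; each statement's English description precedes it below -/
import Mathlib

section
/- Let G be a finite simple graph on n vertices with adjacency matrix A and eigenvalues λ_1 ≥ λ_2 ≥ ... ≥ λ_n (listed with multiplicity). Then the independence number α(G) satisfies α(G) ≤ min{ |{i : λ_i ≥ 0}| , |{i : λ_i ≤ 0}| }. -/
open Polynomial Matrix

/-- The `k`-independence number of a graph: the maximum size of a set of vertices
such that no walk of length at most `k` joins two distinct vertices of the set
(equivalently, pairwise distance greater than `k`). -/
noncomputable def kIndepNum {V : Type*} (G : SimpleGraph V) (k : ℕ) : ℕ :=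
  sSup {m | ∃ S : Finset V, S.card = m ∧
    ∀ u ∈ S, ∀ v ∈ S, u ≠ v → ∀ w : G.Walk u v, k < w.length}

/-- A subspace on which the quadratic form of a diagonalizable symmetric operator is nonnegative has
dimension at most the number of nonnegative eigenvalues. -/
theorem Submodule.finrank_le_card_nonneg_eigenvalues {ι E : Type*} [Fintype ι]
    [NormedAddCommGroup E] [InnerProductSpace ℝ E] (b : OrthonormalBasis ι ℝ E) (T : E →ₗ[ℝ] E)
    (μ : ι → ℝ) (hT : ∀ i, T (b i) = μ i • b i) (W : Submodule ℝ E)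
    (hW : ∀ w ∈ W, 0 ≤ inner ℝ w (T w)) :
    Module.finrank ℝ W ≤ (Finset.univ.filter (fun i => 0 ≤ μ i)).card := by
  classical
  let f : W →ₗ[ℝ] ({i // 0 ≤ μ i} → ℝ) :=
    LinearMap.pi fun i => (innerₗ E (b i)).comp W.subtype
  have hf : Function.Injective f := by
    refine (injective_iff_map_eq_zero f).2 fun ⟨w, hw⟩ h => ?_
    have hP : ∀ i, 0 ≤ μ i → inner ℝ (b i) w = 0 := fun i hi => congrFun h ⟨i, hi⟩
    have hquad : inner ℝ w (T w) = ∑ i, μ i * inner ℝ (b i) w ^ 2 := by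
      have hTw : T w = ∑ i, (inner ℝ (b i) w * μ i) • b i := by
        conv_lhs => rw [← b.sum_repr' w]
        simp [hT, smul_smul]
      rw [hTw, inner_sum]
      refine Finset.sum_congr rfl fun i _ => ?_
      rw [real_inner_smul_right, real_inner_comm]
      ring
    have hle : ∀ i ∈ Finset.univ, μ i * inner ℝ (b i) w ^ 2 ≤ 0 := fun i _ => by
      rcases le_or_gt 0 (μ i) with hi | hi
      · simp [hP i hi]
      · exact mul_nonpos_of_nonpos_of_nonneg hi.le (sq_nonneg _)
    have hz := (Finset.sum_eq_zero_iff_of_nonpos hle).1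
      (le_antisymm (Finset.sum_nonpos hle) (hquad ▸ hW w hw))
    have hc : ∀ i, inner ℝ (b i) w = 0 := fun i => by
      rcases le_or_gt 0 (μ i) with hi | hi
      · exact hP i hi
      · simpa [hi.ne] using hz i (Finset.mem_univ i)
    refine Subtype.ext ?_
    change w = 0
    rw [← b.sum_repr' w]
    simp [hc]
  simpa [Fintype.card_subtype] using LinearMap.finrank_le_finrank_of_injective hf

/-- If a square matrix has an orthonormal eigenbasis and vanishes on `S × S`, then `S` has at most
as many elements as there are nonnegative eigenvalues. -/
theorem Matrix.card_le_card_nonneg_eigenvalues {ι : Type*} [Fintype ι] [DecidableEq ι]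
    (A : Matrix ι ι ℝ) (b : OrthonormalBasis ι ℝ (EuclideanSpace ℝ ι)) (μ : ι → ℝ)
    (hb : ∀ i, A *ᵥ ⇑(b i) = μ i • ⇑(b i)) (S : Finset ι)
    (hS : ∀ i ∈ S, ∀ j ∈ S, A i j = 0) :
    S.card ≤ (Finset.univ.filter (fun i => 0 ≤ μ i)).card := by
  let e : S → EuclideanSpace ℝ ι := fun i => EuclideanSpace.basisFun ι ℝ i
  have he : LinearIndependent ℝ e :=
    (EuclideanSpace.basisFun ι ℝ).orthonormal.linearIndependent.comp _ Subtype.val_injective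
  have hsupp : ∀ w ∈ Submodule.span ℝ (Set.range e), ∀ i ∉ S, w i = 0 := by
    intro w hw i hi
    induction hw using Submodule.span_induction with
    | mem x hx =>
      obtain ⟨j, rfl⟩ := hx
      have : i ≠ j := fun h => hi (h ▸ j.2)
      simp [e, this]
    | zero => simp
    | add x y _ _ hx hy => simp [hx, hy]
    | smul a x _ hx => simp [hx]
  have key := Submodule.finrank_le_card_nonneg_eigenvalues b (toEuclideanLin A) μ
    (fun i => by
      ext j
      simpa [toLpLin_apply] using congrFun (hb i) j)
    (Submodule.span ℝ (Set.range e)) (fun w hw => by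
      refine le_of_eq ?_
      simp only [PiLp.inner_apply, toLpLin_apply, mulVec, dotProduct]
      refine (Finset.sum_eq_zero fun i _ => ?_).symm
      by_cases hi : i ∈ S
      · have : ∑ j, A i j * w j = 0 := Finset.sum_eq_zero fun j _ => by
          by_cases hj : j ∈ S
          · simp [hS i hi j hj]
          · simp [hsupp w hw j hj]
        simp [this]
      · simp [hsupp w hw i hi])
  rwa [finrank_span_eq_card he, Fintype.card_coe] at key

theorem Finset.card_filter_eq_of_prod_X_sub_C_eq {ι R : Type*} [Fintype ι] [CommRing R] [IsDomain R]
    {f g : ι → R} (h : ∏ i, (X - C (f i)) = ∏ i, (X - C (g i))) (p : R → Prop) [DecidablePred p] :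
    (Finset.univ.filter (fun i => p (f i))).card =
      (Finset.univ.filter (fun i => p (g i))).card := by
  have hroots : ∀ k : ι → R, (∏ i, (X - C (k i))).roots = Finset.univ.val.map k := fun k => by
    rw [← Polynomial.roots_multiset_prod_X_sub_C (Finset.univ.val.map k), Multiset.map_map]
    rfl
  have hm : Finset.univ.val.map f = Finset.univ.val.map g := by rw [← hroots, h, hroots]
  have hcount := congrArg (Multiset.countP p) hm
  rwa [Multiset.countP_map, Multiset.countP_map] at hcount

/-- Cvetković's inertia bound: the independence number is at most the number of
nonnegative eigenvalues, and at most the number of nonpositive eigenvalues. -/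
theorem cvetkovic_bound {n : ℕ} (G : SimpleGraph (Fin n)) [DecidableRel G.Adj]
    (lam : Fin n → ℝ) (hmono : Antitone lam)
    (hchar : (G.adjMatrix ℝ).charpoly = ∏ i : Fin n, (X - C (lam i))) :
    kIndepNum G 1 ≤
      min (Finset.univ.filter (fun i => 0 ≤ lam i)).card
          (Finset.univ.filter (fun i => lam i ≤ 0)).card := by
  have hA : (G.adjMatrix ℝ).IsHermitian := by
    simp [IsHermitian, conjTranspose_eq_transpose_of_trivial]
  have hprod : ∏ i, (X - C (hA.eigenvalues i)) = ∏ i, (X - C (lam i)) := by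
    simpa [hchar] using hA.charpoly_eq.symm
  refine csSup_le' ?_
  rintro _ ⟨S, rfl, hS⟩
  have hzero : ∀ i ∈ S, ∀ j ∈ S, G.adjMatrix ℝ i j = 0 := fun i hi j hj => by
    have : ¬ G.Adj i j := fun h => by simpa using hS i hi j hj h.ne h.toWalk
    simp [this]
  refine le_min ?_ ?_
  · rw [← Finset.card_filter_eq_of_prod_X_sub_C_eq hprod (fun x => 0 ≤ x)]
    exact card_le_card_nonneg_eigenvalues _ hA.eigenvectorBasis _ hA.mulVec_eigenvectorBasis S hzero
  · rw [← Finset.card_filter_eq_of_prod_X_sub_C_eq hprod (fun x => x ≤ 0)]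
    simpa using card_le_card_nonneg_eigenvalues (-G.adjMatrix ℝ) hA.eigenvectorBasis
      (fun i => -hA.eigenvalues i)
      (fun i => by rw [neg_mulVec, hA.mulVec_eigenvectorBasis, neg_smul]) S
      (fun i hi j hj => by rw [neg_apply, hzero i hi j hj, neg_zero])
end

section
/- Let G be a finite simple graph on n vertices that is δ-regular (every vertex has degree δ), with at least one edge, with adjacency matrix A and eigenvalues λ_1 ≥ ... ≥ λ_n (with multiplicity). Then the independence number satisfies α(G) ≤ n · (−λ_n) / (λ_1 − λ_n). -/
open Polynomial Matrix

open scoped MatrixOrder in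
/-- A real symmetric matrix whose eigenvalues are all at least `μ` has quadratic form at
least `μ` times the squared norm. -/
theorem Matrix.IsHermitian.mul_dotProduct_self_le {V : Type*} [Fintype V] [DecidableEq V]
    {A : Matrix V V ℝ} (hA : A.IsHermitian) {μ : ℝ} (hμ : ∀ r ∈ spectrum ℝ A, μ ≤ r)
    (x : V → ℝ) : μ * (x ⬝ᵥ x) ≤ x ⬝ᵥ A *ᵥ x := by
  have hle : algebraMap ℝ (Matrix V V ℝ) μ ≤ A :=
    (algebraMap_le_iff_le_spectrum (a := A) hA.isSelfAdjoint).2 hμ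
  have h := (Matrix.le_iff.1 hle).dotProduct_mulVec_nonneg x
  rw [sub_mulVec, Algebra.algebraMap_eq_smul_one, smul_mulVec, one_mulVec, dotProduct_sub,
    dotProduct_smul, star_trivial, smul_eq_mul] at h
  linarith

/-- The spectrum of a matrix is the set of roots of its split characteristic polynomial. -/
theorem Matrix.spectrum_eq_range_of_charpoly_eq {V ι K : Type*} [Fintype V] [DecidableEq V]
    [Fintype ι] [Field K] {A : Matrix V V K} {lam : ι → K}
    (h : A.charpoly = ∏ i, (X - C (lam i))) : spectrum K A = Set.range lam := by
  ext r
  rw [Matrix.mem_spectrum_iff_isRoot_charpoly, h, Polynomial.IsRoot, Polynomial.eval_prod,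
    Finset.prod_eq_zero_iff]
  simp [sub_eq_zero, eq_comm]

namespace SimpleGraph

variable {V : Type*} [Fintype V] [DecidableEq V] {G : SimpleGraph V} [DecidableRel G.Adj] {δ : ℕ}

open scoped MatrixOrder in
theorem IsRegularOfDegree.le_of_mem_spectrum_adjMatrix (hreg : G.IsRegularOfDegree δ) {r : ℝ}
    (hr : r ∈ spectrum ℝ (G.adjMatrix ℝ)) : r ≤ δ := by
  have hdeg : algebraMap ℝ (Matrix V V ℝ) δ = G.degMatrix ℝ := by
    rw [degMatrix, Matrix.algebraMap_eq_diagonal]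
    simp [hreg.degree_eq]
  have hle : G.adjMatrix ℝ ≤ algebraMap ℝ (Matrix V V ℝ) δ := by
    rw [hdeg, Matrix.le_iff]
    exact G.posSemidef_lapMatrix ℝ
  exact (le_algebraMap_iff_spectrum_le (a := G.adjMatrix ℝ)
    (G.isHermitian_adjMatrix ℝ).isSelfAdjoint).1 hle r hr

theorem IsRegularOfDegree.degree_mem_spectrum_adjMatrix [Nonempty V]
    (hreg : G.IsRegularOfDegree δ) : (δ : ℝ) ∈ spectrum ℝ (G.adjMatrix ℝ) := by
  rw [← Matrix.spectrum_toLin']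
  refine Module.End.HasEigenvalue.mem_spectrum
    (Module.End.hasEigenvalue_of_hasEigenvector (x := Function.const V 1) ⟨?_, ?_⟩)
  · rw [Module.End.mem_eigenspace_iff]
    ext v
    rw [Matrix.toLin'_apply, adjMatrix_mulVec_const_apply_of_regular hreg]
    simp
  · intro h
    simpa using congrFun h (Classical.arbitrary V)

/-- Hoffman's inequality, for a single independent set and any lower bound `μ` of the spectrum. -/
theorem IsRegularOfDegree.card_mul_sub_le_of_isIndepSet (hreg : G.IsRegularOfDegree δ) {μ : ℝ}
    (hμ : ∀ r ∈ spectrum ℝ (G.adjMatrix ℝ), μ ≤ r) {S : Finset V} (hne : S.Nonempty)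
    (hS : G.IsIndepSet S) : (S.card : ℝ) * (δ - μ) ≤ Fintype.card V * -μ := by
  set s : ℝ := (S.card : ℝ)
  set n : ℝ := (Fintype.card V : ℝ)
  have hs : 0 < s := by simpa [s] using hne
  have hn : 0 < n := by
    have : Nonempty V := ⟨hne.choose⟩
    simpa [n] using Fintype.card_pos
  let e : V → ℝ := fun v => if v ∈ S then 1 else 0
  have hone : G.adjMatrix ℝ *ᵥ 1 = (δ : ℝ) • 1 := by
    ext v
    simpa using adjMatrix_mulVec_const_apply_of_regular (a := (1 : ℝ)) hreg (v := v)
  have hvone : (1 : V → ℝ) ᵥ* G.adjMatrix ℝ = (δ : ℝ) • 1 := by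
    rw [← hone, ← mulVec_transpose, transpose_adjMatrix]
  have hee : e ⬝ᵥ e = s := by simp [e, s, dotProduct]
  have he1 : e ⬝ᵥ 1 = s := by simp [e, s, dotProduct]
  have h11 : (1 : V → ℝ) ⬝ᵥ 1 = n := by simp [n]
  have heAe : e ⬝ᵥ G.adjMatrix ℝ *ᵥ e = 0 := by
    rw [dotProduct_mulVec_adjMatrix]
    refine Finset.sum_eq_zero fun i _ => Finset.sum_eq_zero fun j _ => ?_
    by_cases hij : G.Adj i j
    · by_cases hi : i ∈ S
      · have hj : j ∉ S := fun hj => hS hi hj hij.ne hij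
        simp [e, hj]
      · simp [e, hi]
    · simp [hij]
  have hq := (G.isHermitian_adjMatrix ℝ).mul_dotProduct_self_le hμ (n • e - s • 1)
  have h1Ae : (1 : V → ℝ) ⬝ᵥ G.adjMatrix ℝ *ᵥ e = δ * s := by
    rw [dotProduct_mulVec, hvone, smul_dotProduct, dotProduct_comm, he1, smul_eq_mul]
  simp only [mulVec_sub, mulVec_smul, sub_dotProduct, dotProduct_sub, smul_dotProduct,
    dotProduct_smul, smul_eq_mul, hone, heAe, h1Ae, hee, he1, dotProduct_comm 1 e, h11] at hq
  have hns : 0 < n * s := mul_pos hn hs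
  refine le_of_mul_le_mul_left ?_ hns
  linarith

end SimpleGraph

theorem exists_isIndepSet_card_eq_kIndepNum_one {V : Type*} [Fintype V] (G : SimpleGraph V) :
    ∃ S : Finset V, S.card = kIndepNum G 1 ∧ G.IsIndepSet S := by
  have hmem := Nat.sSup_mem (s := {m | ∃ S : Finset V, S.card = m ∧
      ∀ u ∈ S, ∀ v ∈ S, u ≠ v → ∀ w : G.Walk u v, 1 < w.length})
    ⟨0, ∅, by simp⟩ ⟨Fintype.card V, by rintro _ ⟨S, rfl, -⟩; exact S.card_le_univ⟩
  obtain ⟨S, hcard, hS⟩ := hmem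
  refine ⟨S, hcard, fun u hu v hv huv hadj => ?_⟩
  simpa using hS u hu v hv huv hadj.toWalk

/-- Hoffman's ratio bound for the independence number of a regular graph. -/
theorem hoffman_bound {n : ℕ} (hn : 0 < n) (G : SimpleGraph (Fin n)) [DecidableRel G.Adj]
    (δ : ℕ) (hreg : G.IsRegularOfDegree δ) (hedge : G.edgeSet.Nonempty)
    (lam : Fin n → ℝ) (hmono : Antitone lam)
    (hchar : (G.adjMatrix ℝ).charpoly = ∏ i : Fin n, (X - C (lam i))) :
    (kIndepNum G 1 : ℝ) ≤
      n * (-(lam ⟨n - 1, Nat.sub_lt hn one_pos⟩)) /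
        (lam ⟨0, hn⟩ - lam ⟨n - 1, Nat.sub_lt hn one_pos⟩) := by
  set μ := lam ⟨n - 1, Nat.sub_lt hn one_pos⟩
  set L := lam ⟨0, hn⟩
  have : Nonempty (Fin n) := ⟨⟨0, hn⟩⟩
  have hspec := Matrix.spectrum_eq_range_of_charpoly_eq hchar
  have hμ : ∀ r ∈ spectrum ℝ (G.adjMatrix ℝ), μ ≤ r := by
    rw [hspec]
    rintro _ ⟨i, rfl⟩
    exact hmono (Fin.mk_le_mk.2 (Nat.le_sub_one_of_lt i.2))
  have hLδ : L = δ := by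
    refine le_antisymm (hreg.le_of_mem_spectrum_adjMatrix (hspec ▸ Set.mem_range_self _)) ?_
    obtain ⟨i, hi⟩ := hspec ▸ hreg.degree_mem_spectrum_adjMatrix
    exact hi ▸ hmono (Fin.mk_le_mk.2 (Nat.zero_le i))
  have hδ : (0 : ℝ) < δ := by
    obtain ⟨⟨u, v⟩, huv⟩ := hedge
    rw [← hreg u]
    exact_mod_cast (G.degree_pos_iff_exists_adj u).2 ⟨v, huv⟩
  have hn' : (1 : ℝ) ≤ n := by exact_mod_cast hn
  have hμ0 : μ < 0 := by
    have h := hreg.card_mul_sub_le_of_isIndepSet hμ (Finset.singleton_nonempty ⟨0, hn⟩) (by simp)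
    simp only [Finset.card_singleton, Fintype.card_fin] at h
    by_contra! h0
    push_cast at h
    nlinarith [mul_nonneg (sub_nonneg.2 hn') h0]
  rw [hLδ, le_div_iff₀ (by linarith)]
  obtain ⟨S, hcard, hS⟩ := exists_isIndepSet_card_eq_kIndepNum_one G
  rw [← hcard]
  obtain rfl | hne := S.eq_empty_or_nonempty
  · simpa using mul_nonneg (zero_le_one.trans hn') (neg_nonneg.2 hμ0.le)
  · simpa using hreg.card_mul_sub_le_of_isIndepSet hμ hne hS
end

section
/- Let G be a connected δ-regular finite simple graph on n vertices with adjacency matrix A that is k-partially walk-regular for some k ≥ 1. Let q be a real polynomial of degree at most k such that every diagonal entry of q(A) equals 1. Let λ = min{ q(θ) : θ an eigenvalue of A with θ ≠ δ }, and assume q(δ) > λ. Then the k-independence number satisfies α_k(G) ≤ n · (1 − λ) / ( q(δ) − λ ). -/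
open Polynomial Matrix

namespace Matrix

variable {ι : Type*} [Fintype ι] [DecidableEq ι]

theorem aeval_mulVec_of_mulVec_eq_smul {R : Type*} [CommRing R] {A : Matrix ι ι R} {v : ι → R}
    {μ : R} (h : A *ᵥ v = μ • v) (q : R[X]) : aeval A q *ᵥ v = q.eval μ • v := by
  induction q using Polynomial.induction_on' with
  | add p q hp hq => simp [add_mulVec, add_smul, hp, hq]
  | monomial m a =>
    have hpow : A ^ m *ᵥ v = μ ^ m • v := by
      induction m with
      | zero => simp
      | succ m ih => rw [pow_succ, ← mulVec_mulVec, h, mulVec_smul, ih, smul_smul, pow_succ']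
    rw [aeval_monomial, eval_monomial, ← Algebra.smul_def, smul_mulVec, hpow, smul_smul]

theorem IsSymm.aeval {R : Type*} [CommRing R] {A : Matrix ι ι R} (hA : A.IsSymm) (q : R[X]) :
    (aeval A q).IsSymm := by
  simp [IsSymm, aeval_eq_sum_range, transpose_sum, transpose_smul, transpose_pow, hA.eq]

/-- If `y` is orthogonal to every eigenvector of `A` whose eigenvalue is mapped below `c` by `q`,
then the quadratic form of `q(A)` at `y` is at least `c` times the squared norm of `y`. -/
theorem IsHermitian.mul_dotProduct_self_le_dotProduct_aeval_mulVec {A : Matrix ι ι ℝ}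
    (hA : A.IsHermitian) (q : ℝ[X]) (c : ℝ) (y : ι → ℝ)
    (h : ∀ μ ∈ spectrum ℝ A, c ≤ q.eval μ ∨ ∀ v : ι → ℝ, A *ᵥ v = μ • v → v ⬝ᵥ y = 0) :
    c * (y ⬝ᵥ y) ≤ y ⬝ᵥ (aeval A q *ᵥ y) := by
  have hsymm : (aeval A q).IsSymm := IsSymm.aeval (by simpa [IsHermitian, IsSymm] using hA) q
  let b := hA.eigenvectorBasis
  have expand : ∀ z : ι → ℝ, y ⬝ᵥ z = ∑ i, ((b i).ofLp ⬝ᵥ y) * ((b i).ofLp ⬝ᵥ z) := fun z ↦ by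
    have := b.sum_inner_mul_inner (WithLp.toLp 2 y) (WithLp.toLp 2 z)
    simp only [EuclideanSpace.inner_eq_star_dotProduct, star_trivial] at this
    rw [dotProduct_comm, ← this]
    exact Finset.sum_congr rfl fun i _ ↦ by rw [dotProduct_comm z]
  rw [expand, expand, Finset.mul_sum]
  refine Finset.sum_le_sum fun i _ ↦ ?_
  have heig : A *ᵥ (b i).ofLp = hA.eigenvalues i • (b i).ofLp := hA.mulVec_eigenvectorBasis i
  have hq : (b i).ofLp ⬝ᵥ (aeval A q *ᵥ y) = q.eval (hA.eigenvalues i) * ((b i).ofLp ⬝ᵥ y) := by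
    rw [dotProduct_mulVec, ← mulVec_transpose, hsymm.eq, aeval_mulVec_of_mulVec_eq_smul heig,
      smul_dotProduct, smul_eq_mul]
  rw [hq]
  rcases h _ (hA.eigenvalues_mem_spectrum_real i) with hc | hv
  · nlinarith [mul_le_mul_of_nonneg_right hc (mul_self_nonneg ((b i).ofLp ⬝ᵥ y))]
  · simp [hv _ heig]

end Matrix

namespace SimpleGraph

variable {V : Type*} [Fintype V] [DecidableEq V] (G : SimpleGraph V) [DecidableRel G.Adj]

theorem aeval_adjMatrix_apply_eq_zero {R : Type*} [CommRing R] {q : R[X]} {k : ℕ}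
    (hq : q.natDegree ≤ k) {u v : V} (huv : ∀ w : G.Walk u v, k < w.length) :
    aeval (G.adjMatrix R) q u v = 0 := by
  rw [aeval_eq_sum_range, Matrix.sum_apply]
  refine Finset.sum_eq_zero fun l hl ↦ ?_
  have : IsEmpty {p : G.Walk u v | p.length = l} :=
    ⟨fun ⟨p, hp⟩ ↦ by
      have := huv p
      simp only [Set.mem_ofPred_eq] at hp
      simp only [Finset.mem_range] at hl
      omega⟩
  simp [Matrix.smul_apply, adjMatrix_pow_apply_eq_card_walk, Fintype.card_eq_zero]

variable {G}

theorem Connected.apply_eq_of_adjMatrix_mulVec_eq_smul (hconn : G.Connected) {δ : ℕ}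
    (hreg : G.IsRegularOfDegree δ) {v : V → ℝ} (hv : G.adjMatrix ℝ *ᵥ v = (δ : ℝ) • v)
    (i j : V) : v i = v j := by
  refine (G.lapMatrix_mulVec_eq_zero_iff_forall_reachable).1 ?_ i j (hconn.preconnected i j)
  ext u
  have := congrFun hv u
  rw [adjMatrix_mulVec_apply] at this
  rw [lapMatrix_mulVec_apply, this, hreg u]
  simp

/-- The quadratic form of `q(A)` at the indicator vector of a set `S`, bounded below through the
decomposition of that vector along the all-ones vector and its orthogonal complement. -/
theorem Connected.card_sq_mul_le_sum_aeval_adjMatrix (hconn : G.Connected) {δ : ℕ}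
    (hreg : G.IsRegularOfDegree δ) (q : ℝ[X]) (c : ℝ)
    (hc : ∀ θ ∈ spectrum ℝ (G.adjMatrix ℝ), θ ≠ δ → c ≤ q.eval θ) (S : Finset V) :
    (q.eval (δ : ℝ) - c) * (S.card : ℝ) ^ 2 ≤
      (Fintype.card V : ℝ) * (∑ u ∈ S, ∑ v ∈ S, aeval (G.adjMatrix ℝ) q u v - c * S.card) := by
  have := hconn.nonempty
  set n : ℝ := (Fintype.card V : ℝ) with hn
  have hn0 : 0 < n := by simpa [hn] using Fintype.card_pos (α := V)
  set Q := aeval (G.adjMatrix ℝ) q with hQ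
  set s : ℝ := (S.card : ℝ) with hs
  let e : V → ℝ := 1
  let x : V → ℝ := fun u ↦ if u ∈ S then 1 else 0
  have hsymm : Q.IsSymm := G.isSymm_adjMatrix.aeval q
  have hQe : Q *ᵥ e = q.eval (δ : ℝ) • e := by
    refine aeval_mulVec_of_mulVec_eq_smul ?_ q
    ext u
    simp [e, adjMatrix_mulVec_apply, hreg u]
  have hxx : x ⬝ᵥ x = s := by simp [x, dotProduct, hs]
  have hxe : x ⬝ᵥ e = s := by simp [x, e, dotProduct, hs]
  have hee : e ⬝ᵥ e = n := by simp [e, dotProduct, hn]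
  have hex : e ⬝ᵥ x = s := by rw [dotProduct_comm, hxe]
  have hxQx : x ⬝ᵥ (Q *ᵥ x) = ∑ u ∈ S, ∑ v ∈ S, Q u v := by
    simp [x, dotProduct, mulVec]
  have heQx : e ⬝ᵥ (Q *ᵥ x) = q.eval (δ : ℝ) * s := by
    rw [dotProduct_mulVec, ← mulVec_transpose, hsymm.eq, hQe, smul_dotProduct, hex, smul_eq_mul]
  have key := (G.isHermitian_adjMatrix ℝ).mul_dotProduct_self_le_dotProduct_aeval_mulVec q c
    (n • x - s • e) fun θ hθ ↦ by
      by_cases hθδ : θ = δ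
      · right
        subst hθδ
        intro v hv
        obtain ⟨i⟩ := this
        have hve : v = v i • e := by
          ext j
          simpa [e] using hconn.apply_eq_of_adjMatrix_mulVec_eq_smul hreg hv j i
        rw [hve, smul_dotProduct, dotProduct_sub, dotProduct_smul, dotProduct_smul, hex, hee]
        simp [mul_comm]
      · exact .inl (hc θ hθ hθδ)
  rw [← hQ] at key
  simp only [mulVec_sub, mulVec_smul, hQe, dotProduct_sub, sub_dotProduct, dotProduct_smul,
    smul_dotProduct, hxx, hxe, hee, hex, hxQx, heQx, smul_eq_mul] at key
  refine le_of_mul_le_mul_left ?_ hn0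
  linarith

end SimpleGraph

/-- Bound on the k-independence number of a k-partially walk-regular graph via
polynomials whose matrix evaluation has all-ones diagonal (Abiad, Coutinho, Fiol). -/
theorem walk_regular_bound {n : ℕ} (G : SimpleGraph (Fin n)) [DecidableRel G.Adj]
    (hconn : G.Connected) (δ : ℕ) (hreg : G.IsRegularOfDegree δ)
    (k : ℕ) (hk : 1 ≤ k)
    (hwalkreg : ∀ l ≤ k, ∀ u v : Fin n,
      ((G.adjMatrix ℝ) ^ l) u u = ((G.adjMatrix ℝ) ^ l) v v)
    (q : Polynomial ℝ) (hdeg : q.natDegree ≤ k)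
    (hdiag : ∀ u : Fin n, (Polynomial.aeval (G.adjMatrix ℝ) q) u u = 1)
    (lam : ℝ)
    (hlam : IsLeast {x | ∃ θ ∈ spectrum ℝ (G.adjMatrix ℝ), θ ≠ (δ : ℝ) ∧ x = q.eval θ} lam)
    (hgt : lam < q.eval (δ : ℝ)) :
    (kIndepNum G k : ℝ) ≤ n * (1 - lam) / (q.eval (δ : ℝ) - lam) := by
  have hne := hconn.nonempty
  have hbound : ∀ S : Finset (Fin n),
      (∀ u ∈ S, ∀ v ∈ S, u ≠ v → ∀ w : G.Walk u v, k < w.length) →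
      (q.eval (δ : ℝ) - lam) * (S.card : ℝ) ^ 2 ≤ n * (1 - lam) * S.card := fun S hS ↦ by
    have hsum : ∑ u ∈ S, ∑ v ∈ S, aeval (G.adjMatrix ℝ) q u v = S.card := by
      have hrow : ∀ u ∈ S, ∑ v ∈ S, aeval (G.adjMatrix ℝ) q u v = 1 := fun u hu ↦ by
        rw [Finset.sum_eq_single_of_mem u hu fun v hv hvu ↦
          G.aeval_adjMatrix_apply_eq_zero hdeg (hS u hu v hv hvu.symm), hdiag]
      simp [Finset.sum_congr rfl hrow]
    have h := hconn.card_sq_mul_le_sum_aeval_adjMatrix hreg q lam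
      (fun θ hθ hne ↦ hlam.2 ⟨θ, hθ, hne, rfl⟩) S
    rw [hsum, Fintype.card_fin] at h
    linarith
  have hmem : kIndepNum G k ∈ {m | ∃ S : Finset (Fin n), S.card = m ∧
      ∀ u ∈ S, ∀ v ∈ S, u ≠ v → ∀ w : G.Walk u v, k < w.length} :=
    Nat.sSup_mem ⟨0, ∅, by simp⟩ ⟨n, by
      rintro _ ⟨S, rfl, -⟩
      simpa using S.card_le_univ⟩
  obtain ⟨S, hcard, hS⟩ := hmem
  rw [← hcard, le_div_iff₀ (sub_pos.2 hgt)]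
  rcases S.eq_empty_or_nonempty with rfl | hSne
  · obtain ⟨i⟩ := hne
    have h := hbound {i} (by simp)
    simp only [Finset.card_singleton, Nat.cast_one, one_pow, mul_one] at h
    simp only [Finset.card_empty, Nat.cast_zero, zero_mul]
    linarith
  · have hpos : (0 : ℝ) < S.card := by exact_mod_cast hSne.card_pos
    refine le_of_mul_le_mul_right ?_ hpos
    linarith [hbound S hS]
end

section
/- Let G be a finite simple graph with adjacency matrix A whose distinct eigenvalues are θ_0 > θ_1 > ... > θ_d, and let 0 ≤ k < d. Let P_k denote the set of real polynomials p of degree at most k with p(θ_0) = 1 and p(θ_i) ≥ 0 for i = 1,...,d, and similarly P_{k+1}. If p minimizes trace(·(A)) over P_k and q minimizes trace(·(A)) over P_{k+1}, then trace(q(A)) < trace(p(A)). -/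
open Polynomial Matrix

/-- The trace of a polynomial in a real Hermitian matrix is the sum of its values at the
eigenvalues. -/
theorem Matrix.IsHermitian.trace_aeval_eq_sum {ι : Type*} [Fintype ι] [DecidableEq ι]
    {A : Matrix ι ι ℝ} (hA : A.IsHermitian) (p : ℝ[X]) :
    (aeval A p).trace = ∑ i, p.eval (hA.eigenvalues i) := by
  set φ := Unitary.conjStarAlgAut ℝ (Matrix ι ι ℝ) (star hA.eigenvectorUnitary)
  have hA' : φ A = Matrix.diagonalAlgHom ℝ hA.eigenvalues :=
    hA.conjStarAlgAut_star_eigenvectorUnitary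
  have hφ : (φ (aeval A p)).trace = (aeval A p).trace := by
    rw [Unitary.conjStarAlgAut_star_apply, Matrix.trace_mul_comm, ← mul_assoc,
      Unitary.mul_star_self_of_mem hA.eigenvectorUnitary.2, one_mul]
  rw [← hφ, ← aeval_algHom_apply, hA', aeval_algHom_apply, aeval_pi_apply]
  simp [Matrix.trace_diagonal, coe_aeval_eq_eval]

/-- A polynomial of degree less than `d` that vanishes at `θ 1, ..., θ d` is zero. -/
theorem exists_ne_zero_eval_ne_zero {d : ℕ} {θ : Fin (d + 1) → ℝ} (hθ : Function.Injective θ)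
    {p : ℝ[X]} (hp : p ≠ 0) (hdeg : p.natDegree < d) :
    ∃ i, i ≠ 0 ∧ p.eval (θ i) ≠ 0 := by
  by_contra! h
  refine hp (eq_zero_of_natDegree_lt_card_of_eval_eq_zero p
    (hθ.comp (Fin.succ_injective d)) (fun i => h i.succ (Fin.succ_ne_zero i)) ?_)
  simpa using hdeg

/-- The minimal trace over the class P_k strictly decreases when k increases
(for k < d): tr q(A) < tr p(A) for minimizers q over P_{k+1} and p over P_k. -/
theorem minor_trace_strict_anti {n d : ℕ} (G : SimpleGraph (Fin n)) [DecidableRel G.Adj]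
    (θ : Fin (d + 1) → ℝ) (hθ : StrictAnti θ)
    (hspec : spectrum ℝ (G.adjMatrix ℝ) = Set.range θ)
    (k : ℕ) (hkd : k < d)
    (p : Polynomial ℝ) (hpdeg : p.natDegree ≤ k)
    (hp0 : p.eval (θ 0) = 1) (hpnn : ∀ i : Fin (d + 1), i ≠ 0 → 0 ≤ p.eval (θ i))
    (hpmin : ∀ p' : Polynomial ℝ, p'.natDegree ≤ k → p'.eval (θ 0) = 1 →
      (∀ i : Fin (d + 1), i ≠ 0 → 0 ≤ p'.eval (θ i)) →
      Matrix.trace (Polynomial.aeval (G.adjMatrix ℝ) p) ≤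
        Matrix.trace (Polynomial.aeval (G.adjMatrix ℝ) p'))
    (q : Polynomial ℝ) (hqdeg : q.natDegree ≤ k + 1)
    (hq0 : q.eval (θ 0) = 1) (hqnn : ∀ i : Fin (d + 1), i ≠ 0 → 0 ≤ q.eval (θ i))
    (hqmin : ∀ q' : Polynomial ℝ, q'.natDegree ≤ k + 1 → q'.eval (θ 0) = 1 →
      (∀ i : Fin (d + 1), i ≠ 0 → 0 ≤ q'.eval (θ i)) →
      Matrix.trace (Polynomial.aeval (G.adjMatrix ℝ) q) ≤
        Matrix.trace (Polynomial.aeval (G.adjMatrix ℝ) q')) :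
    Matrix.trace (Polynomial.aeval (G.adjMatrix ℝ) q) <
      Matrix.trace (Polynomial.aeval (G.adjMatrix ℝ) p) := by
  set ℓ : ℝ[X] := C (θ 0 - θ (Fin.last d))⁻¹ * (X - C (θ (Fin.last d)))
  have hlast : θ (Fin.last d) < θ 0 := hθ (Fin.lt_def.2 (by simp; omega))
  have hpos : 0 < θ 0 - θ (Fin.last d) := sub_pos.2 hlast
  have hℓ (x : ℝ) : ℓ.eval x = (x - θ (Fin.last d)) / (θ 0 - θ (Fin.last d)) := by
    simp [ℓ, div_eq_inv_mul]
  have hℓ0 : ℓ.eval (θ 0) = 1 := by rw [hℓ, div_self hpos.ne']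
  have hℓnn (i) : 0 ≤ ℓ.eval (θ i) := by
    rw [hℓ]
    exact div_nonneg (sub_nonneg.2 (hθ.antitone (Fin.le_last i))) hpos.le
  have hℓlt (i) (hi : i ≠ 0) : ℓ.eval (θ i) < 1 := by
    rw [hℓ, div_lt_one hpos]
    exact sub_lt_sub_right (hθ (Fin.pos_iff_ne_zero.2 hi)) _
  have hdeg : (p * ℓ).natDegree ≤ k + 1 :=
    natDegree_mul_le_of_le hpdeg ((natDegree_C_mul_le _ _).trans (natDegree_X_sub_C_le _))
  refine (hqmin (p * ℓ) hdeg (by simp [hp0, hℓ0])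
    fun i hi => by simpa using mul_nonneg (hpnn i hi) (hℓnn i)).trans_lt ?_
  have hA := G.isHermitian_adjMatrix ℝ
  have hrange : Set.range hA.eigenvalues = Set.range θ := by
    rw [← hA.spectrum_real_eq_range_eigenvalues, hspec]
  rw [hA.trace_aeval_eq_sum, hA.trace_aeval_eq_sum]
  refine Finset.sum_lt_sum (fun j _ => ?_) ?_
  · obtain ⟨i, hi⟩ : hA.eigenvalues j ∈ Set.range θ := hrange ▸ Set.mem_range_self j
    rw [← hi, eval_mul]
    rcases eq_or_ne i 0 with rfl | hi0
    · simp [hℓ0]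
    · exact mul_le_of_le_one_right (hpnn i hi0) (hℓlt i hi0).le
  · have hp : p ≠ 0 := by rintro rfl; simp at hp0
    obtain ⟨i, hi0, hi⟩ := exists_ne_zero_eval_ne_zero hθ.injective hp (hpdeg.trans_lt hkd)
    obtain ⟨j, hj⟩ : θ i ∈ Set.range hA.eigenvalues := hrange ▸ Set.mem_range_self i
    refine ⟨j, Finset.mem_univ j, ?_⟩
    rw [hj, eval_mul]
    exact mul_lt_of_lt_one_right ((hpnn i hi0).lt_of_ne' hi) (hℓlt i hi0)
end

section
/- Let G be a finite simple graph on n vertices with adjacency matrix A having at least two distinct eigenvalues, with largest eigenvalue θ_0 and smallest eigenvalue θ_d. Then the polynomial p_1(x) = (x − θ_d)/(θ_0 − θ_d) minimizes trace(p(A)) over all real polynomials p of degree at most 1 with p(θ_0) = 1 and p(θ) ≥ 0 for every eigenvalue θ of A; moreover trace(p_1(A)) = n·(−θ_d)/(θ_0 − θ_d). -/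
open Polynomial Matrix

/-- The largest eigenvalue of a trace-free real symmetric matrix is nonnegative. -/
theorem Matrix.IsHermitian.nonneg_of_isGreatest_spectrum {ι : Type*} [Fintype ι] [DecidableEq ι]
    {A : Matrix ι ι ℝ} (hA : A.IsHermitian) (htr : A.trace = 0) {t : ℝ}
    (ht : IsGreatest (spectrum ℝ A) t) : 0 ≤ t := by
  have hmem := ht.1
  rw [hA.spectrum_real_eq_range_eigenvalues] at hmem
  obtain ⟨i, -⟩ := hmem
  by_contra! hneg
  have hsum : ∑ j, hA.eigenvalues j < 0 :=
    Finset.sum_neg (fun j _ => (ht.2 (hA.eigenvalues_mem_spectrum_real j)).trans_lt hneg)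
      ⟨i, Finset.mem_univ i⟩
  have htrace := hA.trace_eq_sum_eigenvalues
  simp only [htr, RCLike.ofReal_real_eq_id, id_eq] at htrace
  exact hsum.ne htrace.symm

/-- The trace of a linear polynomial evaluated at a trace-free matrix. -/
theorem Matrix.trace_aeval_C_mul_X_add_C {ι R : Type*} [Fintype ι] [DecidableEq ι] [CommRing R]
    {A : Matrix ι ι R} (htr : A.trace = 0) (a b : R) :
    (aeval A (C a * X + C b)).trace = Fintype.card ι * b := by
  simp only [map_add, map_mul, aeval_C, aeval_X, Algebra.algebraMap_eq_smul_one, smul_mul_assoc,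
    one_mul, trace_add, trace_smul, htr, trace_one, smul_eq_mul, mul_zero, zero_add]
  exact mul_comm _ _

/-- The 1-minor polynomial is p₁(x) = (x - θ_d)/(θ₀ - θ_d): it belongs to the class,
minimizes the trace among degree-≤1 polynomials of the class, and its trace equals
n·(-θ_d)/(θ₀ - θ_d) (Hoffman's bound). -/
theorem minor_polynomial_one {n : ℕ} (G : SimpleGraph (Fin n)) [DecidableRel G.Adj]
    (θ0 θd : ℝ) (hne : θ0 ≠ θd)
    (h0 : IsGreatest (spectrum ℝ (G.adjMatrix ℝ)) θ0)
    (hd : IsLeast (spectrum ℝ (G.adjMatrix ℝ)) θd) :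
    ((C (θ0 - θd)⁻¹ * (X - C θd) : Polynomial ℝ).natDegree ≤ 1 ∧
      (C (θ0 - θd)⁻¹ * (X - C θd) : Polynomial ℝ).eval θ0 = 1 ∧
      (∀ θ ∈ spectrum ℝ (G.adjMatrix ℝ),
        0 ≤ (C (θ0 - θd)⁻¹ * (X - C θd) : Polynomial ℝ).eval θ)) ∧
    (∀ p : Polynomial ℝ, p.natDegree ≤ 1 → p.eval θ0 = 1 →
      (∀ θ ∈ spectrum ℝ (G.adjMatrix ℝ), 0 ≤ p.eval θ) →
      Matrix.trace (Polynomial.aeval (G.adjMatrix ℝ) (C (θ0 - θd)⁻¹ * (X - C θd))) ≤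
        Matrix.trace (Polynomial.aeval (G.adjMatrix ℝ) p)) ∧
    Matrix.trace (Polynomial.aeval (G.adjMatrix ℝ) (C (θ0 - θd)⁻¹ * (X - C θd))) =
      n * (-θd) / (θ0 - θd) := by
  have htr : (G.adjMatrix ℝ).trace = 0 := G.trace_adjMatrix ℝ
  have hθ0 : 0 ≤ θ0 :=
    (G.isHermitian_adjMatrix ℝ).nonneg_of_isGreatest_spectrum htr h0
  have hpos : 0 < θ0 - θd := sub_pos.2 (lt_of_le_of_ne (hd.2 h0.1) hne.symm)
  have hp₁ : (C (θ0 - θd)⁻¹ * (X - C θd) : Polynomial ℝ) =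
      C (θ0 - θd)⁻¹ * X + C (-θd / (θ0 - θd)) := by
    rw [mul_sub, ← C_mul, sub_eq_add_neg, ← C_neg]
    congr 2
    ring
  have htrace : Matrix.trace (aeval (G.adjMatrix ℝ) (C (θ0 - θd)⁻¹ * (X - C θd))) =
      n * (-θd) / (θ0 - θd) := by
    rw [hp₁, Matrix.trace_aeval_C_mul_X_add_C htr, Fintype.card_fin, mul_div_assoc]
  refine ⟨⟨?_, ?_, fun θ hθ => ?_⟩, fun p hdeg hone hnonneg => ?_, htrace⟩
  · rw [hp₁]
    exact natDegree_linear_le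
  · simp [hpos.ne']
  · simpa using mul_nonneg (inv_nonneg.2 hpos.le) (sub_nonneg.2 (hd.2 hθ))
  · obtain ⟨a, b, rfl⟩ := exists_eq_X_add_C_of_natDegree_le_one hdeg
    have hpd := hnonneg θd hd.1
    simp only [eval_add, eval_mul, eval_C, eval_X] at hone hpd
    rw [htrace, Matrix.trace_aeval_C_mul_X_add_C htr, Fintype.card_fin, mul_div_assoc]
    refine mul_le_mul_of_nonneg_left ?_ n.cast_nonneg
    rw [div_le_iff₀ hpos]
    linear_combination mul_nonneg hθ0 hpd + θd * hone
end

section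
/- For ℓ ≥ 2, let O_ℓ be the odd graph: its vertices are the (ℓ−1)-element subsets of a (2ℓ−1)-element set, two vertices being adjacent exactly when the corresponding subsets are disjoint. Then the independence number of O_ℓ satisfies α_1(O_ℓ) ≤ binomial(2ℓ, ℓ)·(ℓ−1) / (4ℓ − 2). -/
open Polynomial Matrix

/-- The odd graph O_ℓ: vertices are the (ℓ-1)-element subsets of a (2ℓ-1)-element
set, two vertices adjacent iff the subsets are disjoint. -/
def oddGraph (l : ℕ) : SimpleGraph {s : Finset (Fin (2 * l - 1)) // s.card = l - 1} :=
  SimpleGraph.fromRel (fun u v => Disjoint u.1 v.1)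

/-- The Erdős–Ko–Rado bound `(2 * m + 2).choose m` in terms of the central binomial coefficient. -/
theorem choose_two_mul_mul_sub_one (m : ℕ) :
    (2 * (m + 2)).choose (m + 2) * (m + 1) = (4 * m + 6) * (2 * m + 2).choose m := by
  have h1 := Nat.add_one_mul_choose_eq (2 * m + 2) m
  have h2 : (2 * m + 3).choose (m + 2) = (2 * m + 3).choose (m + 1) :=
    Nat.choose_symm_of_eq_add (by omega)
  have h3 : (2 * (m + 2)).choose (m + 2) =
      (2 * m + 3).choose (m + 1) + (2 * m + 3).choose (m + 2) :=
    Nat.choose_succ_succ (2 * m + 3) (m + 1)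
  rw [h3, h2]
  linarith

/-- A 1-independent set of vertices of the odd graph is an intersecting family, so its size is
bounded by the Erdős–Ko–Rado theorem. -/
theorem kIndepNum_oddGraph_one_le {l : ℕ} (hl : 2 ≤ l) :
    kIndepNum (oddGraph l) 1 ≤ (2 * l - 1 - 1).choose (l - 1 - 1) := by
  refine csSup_le ⟨0, ∅, by simp⟩ ?_
  rintro _ ⟨S, rfl, hS⟩
  rw [← S.card_map (Function.Embedding.subtype _)]
  refine Finset.erdos_ko_rado ?_ ?_ (by omega)
  · intro a ha b hb hab
    obtain ⟨u, hu, rfl⟩ := Finset.mem_map.mp ha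
    obtain ⟨v, hv, rfl⟩ := Finset.mem_map.mp hb
    by_cases huv : u = v
    · subst huv
      have h0 : 0 = l - 1 := (Finset.card_eq_zero.mpr (disjoint_self.mp hab)).symm.trans u.2
      omega
    · have hadj : (oddGraph l).Adj u v :=
        (SimpleGraph.fromRel_adj _ _ _).mpr ⟨huv, Or.inl hab⟩
      simpa using hS u hu v hv huv hadj.toWalk
  · intro a ha
    obtain ⟨u, _, rfl⟩ := Finset.mem_map.mp ha
    exact u.2

/-- Bound on the independence number of the odd graph O_ℓ. -/
theorem oddGraph_alpha1 (l : ℕ) (hl : 2 ≤ l) :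
    (kIndepNum (oddGraph l) 1 : ℝ) ≤
      (Nat.choose (2 * l) l : ℝ) * ((l : ℝ) - 1) / (4 * (l : ℝ) - 2) := by
  obtain ⟨m, rfl⟩ := Nat.exists_eq_add_of_le' hl
  have hle : (kIndepNum (oddGraph (m + 2)) 1 : ℝ) ≤ (2 * m + 2).choose m :=
    Nat.cast_le.mpr (kIndepNum_oddGraph_one_le hl)
  have hid : ((2 * (m + 2)).choose (m + 2) : ℝ) * (m + 1) =
      (4 * m + 6) * (2 * m + 2).choose m := mod_cast choose_two_mul_mul_sub_one m
  rw [le_div_iff₀ (by push_cast; linarith [m.cast_nonneg (α := ℝ)])]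
  have hm : (0 : ℝ) ≤ 4 * m + 6 := by positivity
  push_cast
  linarith [mul_le_mul_of_nonneg_left hle hm]
end

section
/- For every odd ℓ ≥ 3, the odd graph O_ℓ has no 1-perfect code: there is no set C of vertices of O_ℓ such that every vertex of O_ℓ is at distance at most 1 from exactly one vertex of C. -/
open Polynomial Matrix

theorem oddGraph_adj {l : ℕ} (hl : 2 ≤ l)
    {u v : {s : Finset (Fin (2 * l - 1)) // s.card = l - 1}} :
    (oddGraph l).Adj u v ↔ Disjoint u.1 v.1 := by
  rw [oddGraph, SimpleGraph.fromRel_adj, disjoint_comm (a := v.1), or_self]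
  refine ⟨And.right, fun h => ⟨?_, h⟩⟩
  rintro rfl
  have hu := u.2
  rw [disjoint_self.mp h, Finset.bot_eq_empty, Finset.card_empty] at hu
  omega

/-- A finite set is of even size if it is partitioned by two-element subsets. -/
theorem even_card_of_partition_pairs {α ι : Type*} [DecidableEq α] (P : Finset α)
    (T : Finset ι) (f : ι → Finset α) (hsub : ∀ b ∈ T, f b ⊆ P)
    (hcard : ∀ b ∈ T, (f b).card = 2) (huniq : ∀ y ∈ P, ∃! b, b ∈ T ∧ y ∈ f b) :
    Even P.card := by
  have hP : P = T.biUnion f := by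
    ext y
    rw [Finset.mem_biUnion]
    exact ⟨fun hy => (huniq y hy).exists, fun ⟨b, hb, hy⟩ => hsub b hb hy⟩
  have hdisj : (T : Set ι).PairwiseDisjoint f := by
    intro b hb c hc hbc
    refine Finset.disjoint_left.mpr fun y hyb hyc => hbc ?_
    exact (huniq y (hsub b hb hyb)).unique ⟨hb, hyb⟩ ⟨hc, hyc⟩
  rw [hP, Finset.card_biUnion hdisj, Finset.sum_congr rfl hcard, Finset.sum_const, smul_eq_mul]
  exact even_two.mul_left _

/-- For odd ℓ ≥ 3, the odd graph O_ℓ has no 1-perfect code: no set C of vertices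
such that every vertex is at distance at most 1 from exactly one vertex of C. -/
theorem oddGraph_no_perfect_code (l : ℕ) (hl : 3 ≤ l) (hlodd : Odd l) :
    ¬ ∃ C : Set {s : Finset (Fin (2 * l - 1)) // s.card = l - 1},
      ∀ v, ∃! c, c ∈ C ∧ (v = c ∨ (oddGraph l).Adj v c) := by
  classical
  rintro ⟨C, hC⟩
  simp only [oddGraph_adj (show 2 ≤ l by omega)] at hC
  obtain ⟨s, hs⟩ : ∃ s : Finset (Fin (2 * l - 1)), s.card = l - 1 := by
    obtain ⟨s, -, hs⟩ := Finset.exists_subset_card_eq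
      (s := (Finset.univ : Finset (Fin (2 * l - 1)))) (n := l - 1)
      (by rw [Finset.card_univ, Fintype.card_fin]; omega)
    exact ⟨s, hs⟩
  obtain ⟨A, hA, -⟩ := (hC ⟨s, hs⟩).exists
  obtain ⟨x, hx⟩ : A.1.Nonempty := by
    rw [← Finset.card_pos, A.2]
    omega
  have hS : (A.1.erase x).card = l - 2 := by
    rw [Finset.card_erase_of_mem hx, A.2]
    omega
  obtain ⟨z, hz⟩ : (A.1.erase x).Nonempty := by
    rw [← Finset.card_pos, hS]
    omega
  have hP : (A.1ᶜ).card = l := by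
    rw [Finset.card_compl, A.2, Fintype.card_fin]
    omega
  -- Codewords that avoid `A \ {x}` contain `x`, as `A` is within distance one of itself only.
  have hxmem : ∀ B ∈ C, Disjoint (A.1.erase x) B.1 → x ∈ B.1 := by
    intro B hB hd
    by_contra hxB
    have hAB : Disjoint A.1 B.1 := by
      rw [← Finset.insert_erase hx, Finset.disjoint_insert_left]
      exact ⟨hxB, hd⟩
    have h : A = B := (hC A).unique ⟨hA, Or.inl rfl⟩ ⟨hB, Or.inr hAB⟩
    exact Finset.disjoint_left.mp hd hz (h ▸ Finset.mem_of_mem_erase hz)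
  have hcardv : ∀ y ∈ A.1ᶜ, (insert y (A.1.erase x)).card = l - 1 := by
    intro y hy
    rw [Finset.card_insert_of_notMem
      (fun h => Finset.mem_compl.mp hy (Finset.mem_of_mem_erase h)), hS]
    omega
  have heven : Even (A.1ᶜ).card := by
    refine even_card_of_partition_pairs A.1ᶜ
      {B | B ∈ C ∧ Disjoint (A.1.erase x) B.1} (fun B => A.1ᶜ \ B.1)
      (fun B _ => Finset.sdiff_subset) ?_ ?_
    · intro B hB
      simp only [Finset.mem_filter, Finset.mem_univ, true_and] at hB
      have hxB := hxmem B hB.1 hB.2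
      have hinter : B.1 ∩ A.1ᶜ = B.1.erase x := by
        ext y
        have hy : y ∈ A.1.erase x → y ∉ B.1 := fun h => Finset.disjoint_left.mp hB.2 h
        simp only [Finset.mem_inter, Finset.mem_compl, Finset.mem_erase] at hy ⊢
        by_cases hyx : y = x
        · subst hyx
          simp [hx]
        · tauto
      have hB2 := B.2
      rw [Finset.card_sdiff, hinter, Finset.card_erase_of_mem hxB, hP, hB2]
      omega
    · intro y hy
      have hyA := Finset.mem_compl.mp hy
      obtain ⟨c, ⟨hc, hvc⟩, huniq⟩ := hC ⟨insert y (A.1.erase x), hcardv y hy⟩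
      have hd : Disjoint (insert y (A.1.erase x)) c.1 := by
        refine hvc.resolve_left fun hv => ?_
        have hw : ((insert y A.1)ᶜ).card = l - 1 := by
          rw [Finset.card_compl, Finset.card_insert_of_notMem hyA, A.2, Fintype.card_fin]
          omega
        have hAc : A = c := by
          refine (hC ⟨(insert y A.1)ᶜ, hw⟩).unique ⟨hA, Or.inr ?_⟩ ⟨hc, Or.inr ?_⟩
          · exact Disjoint.mono_right (Finset.subset_insert y A.1) disjoint_compl_left
          · rw [← hv]
            exact Disjoint.mono_right (Finset.insert_subset_insert y (Finset.erase_subset x A.1))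
              disjoint_compl_left
        apply hyA
        rw [hAc, ← hv]
        exact Finset.mem_insert_self _ _
      rw [Finset.disjoint_insert_left] at hd
      refine ⟨c, ?_, ?_⟩
      · simp only [Finset.mem_filter, Finset.mem_univ, true_and, Finset.mem_sdiff]
        exact ⟨⟨hc, hd.2⟩, hy, hd.1⟩
      · intro b hb
        simp only [Finset.mem_filter, Finset.mem_univ, true_and, Finset.mem_sdiff] at hb
        exact huniq b ⟨hb.1.1, Or.inr (Finset.disjoint_insert_left.mpr ⟨hb.2.2, hb.1.2⟩)⟩
  rw [hP] at heven
  exact Nat.not_even_iff_odd.mpr hlodd heven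
end

section
/- For ℓ ≥ 3, let O_ℓ be the odd graph: its vertices are the (ℓ−1)-element subsets of a (2ℓ−1)-element set, two vertices being adjacent exactly when the corresponding subsets are disjoint. Then the (ℓ−2)-independence number satisfies α_{ℓ−2}(O_ℓ) ≤ 2ℓ − 1 if ℓ is even, and α_{ℓ−2}(O_ℓ) ≤ 2ℓ − 2 if ℓ is odd. -/
open Polynomial Matrix

/-- Vectors with constant norm and constant pairwise dot product are linearly independent
as soon as the Gram matrix `a • 1 + b • J` has `0 < a` and `0 ≤ b`. -/
theorem linearIndependent_of_dotProduct_eq {ι n : Type*} [Fintype ι] [DecidableEq ι] [Fintype n]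
    (v : ι → n → ℚ) (a b : ℚ) (ha : 0 < a) (hb : 0 ≤ b)
    (h : ∀ i j, v i ⬝ᵥ v j = (if i = j then a else 0) + b) : LinearIndependent ℚ v := by
  rw [Fintype.linearIndependent_iff]
  intro g hg
  have key (j : ι) : a * g j + b * ∑ i, g i = 0 := by
    have h0 : (∑ i, g i • v i) ⬝ᵥ v j = 0 := by rw [hg, zero_dotProduct]
    simp only [sum_dotProduct, smul_dotProduct, h, smul_eq_mul, mul_add, Finset.sum_add_distrib,
      mul_ite, mul_zero, Finset.sum_ite_eq', Finset.mem_univ, if_true, ← Finset.sum_mul] at h0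
    linarith
  have hsum : (a + b * Fintype.card ι) * ∑ i, g i = 0 := by
    have h0 : ∑ j, (a * g j + b * ∑ i, g i) = 0 := Finset.sum_eq_zero fun j _ => key j
    rw [Finset.sum_add_distrib, ← Finset.mul_sum, Finset.sum_const, Finset.card_univ,
      nsmul_eq_mul] at h0
    linarith
  have hpos : a + b * Fintype.card ι ≠ 0 := by positivity
  have hzero : ∑ i, g i = 0 := (mul_eq_zero.1 hsum).resolve_left hpos
  intro j
  have hj := key j
  rw [hzero, mul_zero, add_zero] at hj
  exact (mul_eq_zero.1 hj).resolve_left ha.ne'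

/-- The indicator vector of `A`, translated by the constant `-t`. -/
def shiftedIndicator {n : Type*} [DecidableEq n] (t : ℚ) (A : Finset n) : n → ℚ :=
  fun x => (if x ∈ A then 1 else 0) - t

theorem shiftedIndicator_dotProduct {n : Type*} [Fintype n] [DecidableEq n] (t : ℚ)
    (A B : Finset n) :
    shiftedIndicator t A ⬝ᵥ shiftedIndicator t B =
      (A ∩ B).card - t * (A.card + B.card) + t ^ 2 * Fintype.card n := by
  have h (x : n) : shiftedIndicator t A x * shiftedIndicator t B x =
      (if x ∈ A ∩ B then 1 else 0) - t * ((if x ∈ A then 1 else 0) + (if x ∈ B then 1 else 0))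
        + t ^ 2 := by
    simp only [shiftedIndicator, Finset.mem_inter]
    by_cases hA : x ∈ A <;> by_cases hB : x ∈ B <;> simp [hA, hB] <;> ring
  simp only [dotProduct, h, Finset.sum_add_distrib, Finset.sum_sub_distrib, ← Finset.mul_sum,
    Finset.sum_ite_mem, Finset.univ_inter, Finset.sum_const, nsmul_eq_mul, Finset.card_univ]
  ring

theorem one_dotProduct_shiftedIndicator {n : Type*} [Fintype n] [DecidableEq n] (t : ℚ)
    (A : Finset n) :
    (1 : n → ℚ) ⬝ᵥ shiftedIndicator t A = A.card - t * Fintype.card n := by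
  simp only [dotProduct, shiftedIndicator, Pi.one_apply, one_mul, Finset.sum_sub_distrib,
    Finset.sum_ite_mem, Finset.univ_inter, Finset.sum_const, nsmul_eq_mul, Finset.card_univ]
  ring

/-- A uniform Fisher inequality. -/
theorem card_le_of_uniform_inter {ι n : Type*} [Fintype ι] [Fintype n] [DecidableEq n]
    (A : ι → Finset n) (k m : ℕ) (hmk : m < k) (hA : ∀ i, (A i).card = k)
    (hinter : ∀ i j, i ≠ j → (A i ∩ A j).card = m) : Fintype.card ι ≤ Fintype.card n := by
  classical
  have hli := linearIndependent_of_dotProduct_eq (fun i => shiftedIndicator 0 (A i))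
    ((k : ℚ) - m) m (sub_pos.2 (by exact_mod_cast hmk)) (by positivity) (fun i j => by
      rw [shiftedIndicator_dotProduct]
      split_ifs with h
      · subst h
        simp [hA]
      · simp [hinter i j h])
  simpa using hli.fintype_card_le_finrank

/-- The bound of `card_le_of_uniform_inter` is not attained when the pairwise intersections have
at least the size `k ^ 2 / n` expected of random `k`-subsets. -/
theorem card_lt_of_uniform_inter {ι n : Type*} [Fintype ι] [Fintype n] [DecidableEq n]
    [Nonempty n] (A : ι → Finset n) (k m : ℕ) (hmk : m < k) (hA : ∀ i, (A i).card = k)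
    (hinter : ∀ i j, i ≠ j → (A i ∩ A j).card = m) (hk : k ^ 2 ≤ m * Fintype.card n) :
    Fintype.card ι < Fintype.card n := by
  classical
  have hn : (0 : ℚ) < (Fintype.card n : ℚ) := by exact_mod_cast Fintype.card_pos
  have hk' : (k : ℚ) ^ 2 ≤ m * Fintype.card n := by exact_mod_cast hk
  set N : ℚ := (Fintype.card n : ℚ) with hN
  set v : ι → n → ℚ := fun i => shiftedIndicator (k / N) (A i) with hv
  have hli : LinearIndependent ℚ v := by
    refine linearIndependent_of_dotProduct_eq v ((k : ℚ) - m) (m - k ^ 2 / N)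
      (sub_pos.2 (by exact_mod_cast hmk)) (sub_nonneg.2 ((div_le_iff₀ hn).2 hk')) fun i j => ?_
    rw [hv, shiftedIndicator_dotProduct, ← hN, hA, hA]
    split_ifs with h
    · subst h
      rw [Finset.inter_self, hA]
      field_simp
      ring
    · rw [hinter i j h]
      field_simp
      ring
  have hone : (1 : n → ℚ) ∉ Submodule.span ℚ (Set.range v) := by
    intro hmem
    have horth : ∀ x ∈ Submodule.span ℚ (Set.range v), (1 : n → ℚ) ⬝ᵥ x = 0 := by
      intro x hx
      induction hx using Submodule.span_induction with
      | mem x hx =>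
        obtain ⟨i, rfl⟩ := hx
        rw [hv, one_dotProduct_shiftedIndicator, hA, ← hN]
        field_simp
        ring
      | zero => simp
      | add x y _ _ hx hy => rw [dotProduct_add, hx, hy, add_zero]
      | smul c x _ hx => rw [dotProduct_smul, hx, smul_zero]
    have h1 := horth 1 hmem
    rw [one_dotProduct_one] at h1
    exact hn.ne' h1
  have hcard := (linearIndependent_option'.2 ⟨hli, hone⟩).fintype_card_le_finrank
  simpa [Nat.succ_le_iff] using hcard

theorem oddGraph_adj_of_disjoint {l : ℕ} (hl : 2 ≤ l)
    {u v : {s : Finset (Fin (2 * l - 1)) // s.card = l - 1}} (h : Disjoint u.1 v.1) :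
    (oddGraph l).Adj u v := by
  refine (SimpleGraph.fromRel_adj _ _ _).2 ⟨?_, Or.inl h⟩
  rintro rfl
  have hu := u.2
  rw [disjoint_self.1 h, Finset.bot_eq_empty, Finset.card_empty] at hu
  omega

theorem oddGraph_exists_walk_two_mul {l : ℕ} (hl : 2 ≤ l) (j : ℕ)
    (u v : {s : Finset (Fin (2 * l - 1)) // s.card = l - 1}) (h : (u.1 \ v.1).card = j) :
    ∃ w : (oddGraph l).Walk u v, w.length = 2 * j := by
  induction j generalizing u with
  | zero =>
    have huv : u = v := Subtype.ext <| Finset.eq_of_subset_of_card_le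
      (Finset.sdiff_eq_empty_iff_subset.1 (Finset.card_eq_zero.1 h)) (by rw [u.2, v.2])
    subst huv
    exact ⟨.nil, rfl⟩
  | succ j ih =>
    obtain ⟨a, ha⟩ : (u.1 \ v.1).Nonempty := Finset.card_pos.1 (by omega)
    obtain ⟨b, hb⟩ : (v.1 \ u.1).Nonempty := Finset.card_pos.1 (by
      rw [Finset.card_sdiff_comm (v.2.trans u.2.symm)]; omega)
    rw [Finset.mem_sdiff] at ha hb
    have hcu := u.2
    let u' : {s : Finset (Fin (2 * l - 1)) // s.card = l - 1} :=
      ⟨insert b (u.1.erase a), by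
        rw [Finset.card_insert_of_notMem (fun h => hb.2 (Finset.mem_of_mem_erase h)),
          Finset.card_erase_of_mem ha.1]
        omega⟩
    let c : {s : Finset (Fin (2 * l - 1)) // s.card = l - 1} :=
      ⟨(insert b u.1)ᶜ, by
        rw [Finset.card_compl, Finset.card_insert_of_notMem hb.2, Fintype.card_fin]
        omega⟩
    have huc : (oddGraph l).Adj u c := oddGraph_adj_of_disjoint hl
      (disjoint_compl_right.mono_left (Finset.subset_insert _ _))
    have hcu' : (oddGraph l).Adj c u' := oddGraph_adj_of_disjoint hl
      (disjoint_compl_left.mono_right (Finset.insert_subset_insert _ (Finset.erase_subset _ _)))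
    have hdiff : u'.1 \ v.1 = (u.1 \ v.1).erase a := by
      rw [Finset.insert_sdiff_of_mem _ hb.1, Finset.erase_sdiff_comm]
    obtain ⟨w, hw⟩ := ih u' (by
      rw [hdiff, Finset.card_erase_of_mem (Finset.mem_sdiff.2 ha)]; omega)
    refine ⟨.cons huc (.cons hcu' w), ?_⟩
    rw [SimpleGraph.Walk.length_cons, SimpleGraph.Walk.length_cons, hw]
    ring

theorem oddGraph_exists_walk_two_mul_add_one {l : ℕ} (hl : 2 ≤ l)
    (u v : {s : Finset (Fin (2 * l - 1)) // s.card = l - 1}) :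
    ∃ w : (oddGraph l).Walk u v, w.length = 2 * (u.1 ∩ v.1).card + 1 := by
  obtain ⟨c, huc, hcv, hc⟩ := Finset.exists_subsuperset_card_eq (s := u.1 \ v.1) (t := v.1ᶜ)
    (n := l - 1) (by rw [Finset.sdiff_eq_inter_compl]; exact Finset.inter_subset_right)
    ((Finset.card_le_card Finset.sdiff_subset).trans u.2.le)
    (by rw [Finset.card_compl, v.2, Fintype.card_fin]; omega)
  have hdiff : u.1 \ c = u.1 ∩ v.1 := by
    ext x
    have h1 := @huc x
    have h2 := @hcv x
    simp only [Finset.mem_sdiff, Finset.mem_compl, Finset.mem_inter] at h1 h2 ⊢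
    tauto
  obtain ⟨w, hw⟩ := oddGraph_exists_walk_two_mul hl _ u ⟨c, hc⟩ rfl
  have hadj : (oddGraph l).Adj ⟨c, hc⟩ v :=
    oddGraph_adj_of_disjoint hl (disjoint_compl_left.mono_left hcv)
  refine ⟨w.concat hadj, ?_⟩
  rw [SimpleGraph.Walk.length_concat, hw, hdiff]

/-- Vertices of the odd graph at maximal distance meet in `⌊(l - 1) / 2⌋` points. -/
theorem oddGraph_card_inter_eq {l : ℕ} (hl : 2 ≤ l)
    (u v : {s : Finset (Fin (2 * l - 1)) // s.card = l - 1})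
    (h : ∀ w : (oddGraph l).Walk u v, l - 2 < w.length) :
    (u.1 ∩ v.1).card = (l - 1) / 2 := by
  obtain ⟨w₁, hw₁⟩ := oddGraph_exists_walk_two_mul hl _ u v rfl
  obtain ⟨w₂, hw₂⟩ := oddGraph_exists_walk_two_mul_add_one hl u v
  have h₁ := h w₁
  have h₂ := h w₂
  have hu := Finset.card_sdiff_add_card_inter u.1 v.1
  have := u.2
  omega

/-- Bound on the (ℓ-2)-independence number of the odd graph O_ℓ: at most 2ℓ-1 for
even ℓ and at most 2ℓ-2 for odd ℓ. -/
theorem oddGraph_alpha_lm2 (l : ℕ) (hl : 3 ≤ l) :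
    (Even l → kIndepNum (oddGraph l) (l - 2) ≤ 2 * l - 1) ∧
    (Odd l → kIndepNum (oddGraph l) (l - 2) ≤ 2 * l - 2) := by
  refine ⟨fun _ => csSup_le' ?_, fun hodd => csSup_le' ?_⟩
  · rintro _ ⟨S, rfl, hS⟩
    simpa using card_le_of_uniform_inter (fun i : S => i.1.1) (l - 1) ((l - 1) / 2) (by omega)
      (fun i => i.1.2) fun i j hij => oddGraph_card_inter_eq (by omega) i.1 j.1
        (hS _ i.2 _ j.2 (Subtype.coe_ne_coe.2 hij))
  · rintro _ ⟨S, rfl, hS⟩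
    obtain ⟨r, rfl⟩ := hodd
    have : Nonempty (Fin (2 * (2 * r + 1) - 1)) := ⟨⟨0, by omega⟩⟩
    have hlt := card_lt_of_uniform_inter (fun i : S => i.1.1) (2 * r + 1 - 1)
      ((2 * r + 1 - 1) / 2) (by omega) (fun i => i.1.2)
      (fun i j hij => oddGraph_card_inter_eq (by omega) i.1 j.1
        (hS _ i.2 _ j.2 (Subtype.coe_ne_coe.2 hij)))
      (by
        rw [Fintype.card_fin, show 2 * r + 1 - 1 = 2 * r by omega,
          show 2 * (2 * r + 1) - 1 = 4 * r + 1 by omega, show 2 * r / 2 = r by omega]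
        nlinarith)
    simp only [Fintype.card_coe, Fintype.card_fin] at hlt
    omega
end
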